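/- arXiv:2310.02336 — 3 statements merged into one kernel-verified Lean document; each statement's English description precedes it below -/
import Mathlib

section
/- Let G be a finite simple graph and v a vertex of G whose neighborhood N(v) induces an independent set. If no vertex of N(v) is θ-distinct in G − v, then v is θ-distinct in G. -/
open SimpleGraph

/-- The chromatic number of `G` as a natural number. -/
noncomputable def chi {V : Type*} (G : SimpleGraph V) : ℕ := G.chromaticNumber.toNat

/-- The clique cover number of `G`: the chromatic number of the complement. -/
noncomputable def theta {V : Type*} (G : SimpleGraph V) : ℕ := chi Gᶜ

/-- `G` is `a`-hereditary-Nordhaus-Gaddum: every induced subgraph `H`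
satisfies `χ(H) + θ(H) ≥ |H| + 1 - a`. -/
def IsHNG {V : Type*} [Fintype V] (G : SimpleGraph V) (a : ℕ) : Prop :=
  ∀ s : Finset V, s.card + 1 - a ≤ chi (G.induce (s : Set V)) + theta (G.induce (s : Set V))

/-- `v` is `χ`-distinct in `G`: some proper coloring of `G` with `χ(G)` colors
has `v` alone in its color class. -/
def ChiDistinct {V : Type*} (G : SimpleGraph V) (v : V) : Prop :=
  ∃ C : G.Coloring (Fin (chi G)), ∀ w, C w = C v → w = v

/-- `v` is `θ`-distinct in `G`: some partition of `V(G)` into `θ(G)` cliques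
(equivalently, some proper coloring of the complement with `θ(G)` colors) has
`{v}` as one of its blocks. -/
def ThetaDistinct {V : Type*} (G : SimpleGraph V) (v : V) : Prop :=
  ∃ C : Gᶜ.Coloring (Fin (theta G)), ∀ w, C w = C v → w = v

/-- A finite graph `G` has a proper coloring with `chi G` colors. -/
theorem colorable_chi {V : Type*} [Finite V] (G : SimpleGraph V) : G.Colorable (chi G) :=
  G.colorable_chromaticNumber_of_fintype

/-- Two distinct vertices with the same color in a coloring of the complement are adjacent. -/
theorem adj_of_compl_coloring_eq {V α : Type*} {G : SimpleGraph V} (C : Gᶜ.Coloring α) {a b : V}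
    (hne : a ≠ b) (hC : C a = C b) : G.Adj a b := by
  by_contra hadj
  exact C.valid ((compl_adj _ _ _).2 ⟨hne, hadj⟩) hC

/-- If deleting `v` lowers the clique cover number, then `v` is `θ`-distinct. -/
theorem thetaDistinct_of_theta_induce_lt {V : Type*} [Finite V] {G : SimpleGraph V} {v : V}
    (hlt : theta (G.induce ({v}ᶜ : Set V)) < theta G) : ThetaDistinct G v := by
  classical
  obtain ⟨C⟩ := colorable_chi (G.induce ({v}ᶜ : Set V))ᶜ
  let f : V → Fin (theta G) := fun x =>
    if hx : x = v then ⟨theta (G.induce ({v}ᶜ : Set V)), hlt⟩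
    else Fin.castLE hlt.le (C ⟨x, hx⟩)
  have hv : f v = ⟨theta (G.induce ({v}ᶜ : Set V)), hlt⟩ := dif_pos rfl
  have hf (x : V) (hx : x ≠ v) : f x = Fin.castLE hlt.le (C ⟨x, hx⟩) := dif_neg hx
  have hfv (x : V) (hx : x ≠ v) : f x ≠ f v := by
    rw [hf x hx, hv]
    exact Fin.ne_of_val_ne (C ⟨x, hx⟩).isLt.ne
  refine ⟨Coloring.mk f ?_, fun w hw => by_contra fun hne => hfv w hne hw⟩
  intro a b hab heq
  by_cases ha : a = v
  · subst ha
    exact hfv b hab.ne' heq.symm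
  by_cases hb : b = v
  · subst hb
    exact hfv a hab.ne heq
  rw [hf a ha, hf b hb] at heq
  have hadj := adj_of_compl_coloring_eq C (fun e => hab.ne (congrArg Subtype.val e))
    (Fin.castLE_injective _ heq)
  exact ((compl_adj _ _ _).1 hab).2 hadj

/-- If the neighborhood of `v` induces an independent set and no neighbor of
`v` is `θ`-distinct in `G - v`, then `v` is `θ`-distinct in `G`. -/
theorem stmt_7 {V : Type*} [Fintype V] (G : SimpleGraph V) (v : V)
    (hind : (G.neighborSet v).Pairwise fun a b => ¬ G.Adj a b)
    (h : ∀ w : ({v}ᶜ : Set V), (w : V) ∈ G.neighborSet v →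
      ¬ ThetaDistinct (G.induce ({v}ᶜ : Set V)) w) :
    ThetaDistinct G v := by
  rcases lt_or_ge (theta (G.induce ({v}ᶜ : Set V))) (theta G) with hlt | hle
  · exact thetaDistinct_of_theta_induce_lt hlt
  obtain ⟨C⟩ := colorable_chi Gᶜ
  refine ⟨C, fun w hw => ?_⟩
  by_contra hne
  have hvw := adj_of_compl_coloring_eq C (Ne.symm hne) hw.symm
  refine h ⟨w, hne⟩ hvw ⟨Coloring.mk (fun x => Fin.castLE hle (C x)) ?_, ?_⟩
  · intro a b hab heq
    have hadj := adj_of_compl_coloring_eq C (fun e => hab.ne (Subtype.ext e))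
      (Fin.castLE_injective _ heq)
    exact ((compl_adj _ _ _).1 hab).2 hadj
  · intro u hu
    have hu' : C u = C w := Fin.castLE_injective hle hu
    by_contra huw
    have huw' : (u : V) ≠ w := fun e => huw (Subtype.ext e)
    have hvu := adj_of_compl_coloring_eq C (Ne.symm u.2) (hw.symm.trans hu'.symm)
    exact hind hvu hvw huw' (adj_of_compl_coloring_eq C huw' hu')
end

section
/- If a finite simple graph G is 1-HNG, then G contains no induced subgraph isomorphic to the path P6 on six vertices, to a cycle C_m with m ≥ 6, or to the complement of P6 or of a cycle C_m with m ≥ 6. -/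
open SimpleGraph

/-- `G` contains an induced copy of `H` if some induced subgraph of `G` is
isomorphic to `H`. -/
def HasInducedCopy {V W : Type*} (G : SimpleGraph V) (H : SimpleGraph W) : Prop :=
  ∃ s : Finset V, Nonempty ((G.induce (s : Set V)) ≃g H)

lemma chi_le_of_colorable {V : Type*} {G : SimpleGraph V} {n : ℕ} (h : G.Colorable n) :
    chi G ≤ n :=
  ENat.toNat_le_of_le_natCast h.chromaticNumber_le

lemma HasInducedCopy.nonempty_embedding {V W : Type*} {G : SimpleGraph V} {H : SimpleGraph W}
    (h : HasInducedCopy G H) : Nonempty (H ↪g G) := by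
  obtain ⟨s, ⟨e⟩⟩ := h
  exact ⟨(Embedding.induce (s : Set V)).comp e.symm.toEmbedding⟩

/-- A graph containing an induced copy of a graph `H` with `χ(H) + θ(H) < |H|` is not `1`-HNG. -/
lemma IsHNG.card_le_add_of_colorable {V W : Type*} [Fintype V] [Fintype W] {G : SimpleGraph V}
    {H : SimpleGraph W} (hG : IsHNG G 1) (f : H ↪g G) {a b : ℕ} (ha : H.Colorable a)
    (hb : Hᶜ.Colorable b) : Fintype.card W ≤ a + b := by
  classical
  let s : Finset V := Finset.univ.map f.toEmbedding
  have hs (x : (s : Set V)) : ∃ w, f w = x := by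
    obtain ⟨w, -, hw⟩ := Finset.mem_map.1 x.2
    exact ⟨w, hw⟩
  choose g hg using hs
  have hadj (x y : (s : Set V)) : H.Adj (g x) (g y) ↔ G.Adj x y := by
    rw [← f.map_adj_iff, hg, hg]
  have hinj : Function.Injective g := fun x y hxy ↦ Subtype.ext (by rw [← hg, ← hg, hxy])
  have h₁ : (G.induce (s : Set V)).Colorable a :=
    ha.of_hom ⟨g, fun {x y} h ↦ (hadj x y).2 h⟩
  have h₂ : (G.induce (s : Set V))ᶜ.Colorable b :=
    hb.of_hom ⟨g, fun {x y} h ↦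
      (compl_adj ..).2 ⟨hinj.ne h.1, fun h' ↦ h.2 ((hadj x y).1 h')⟩⟩
  have := hG s
  have hcard : s.card = Fintype.card W := by simp [s]
  have := chi_le_of_colorable h₁
  have : theta (G.induce (s : Set V)) ≤ b := chi_le_of_colorable h₂
  omega

/-- The first six vertices of a longer cycle induce a path. -/
def pathGraphSixEmbeddingCycleGraph (m : ℕ) (hm : 7 ≤ m) : pathGraph 6 ↪g cycleGraph m where
  toFun := Fin.castLE (by omega)
  inj' := Fin.castLE_injective _
  map_rel_iff' {i j} := by
    have mod_sub (a b : ℕ) (ha : a < 6) (hb : b < 6) :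
        (m - b + a) % m = if b ≤ a then a - b else m - b + a := by
      split_ifs with h
      · rw [show m - b + a = m + (a - b) by omega, Nat.add_mod_left, Nat.mod_eq_of_lt (by omega)]
      · exact Nat.mod_eq_of_lt (by omega)
    simp only [Function.Embedding.coeFn_mk, cycleGraph_adj', pathGraph_adj, Fin.sub_def,
      Fin.val_castLE, mod_sub _ _ i.2 j.2, mod_sub _ _ j.2 i.2]
    split_ifs <;> omega

lemma colorable_pathGraph_six : (pathGraph 6).Colorable 2 :=
  ⟨Coloring.mk (fun i ↦ ⟨i % 2, by omega⟩) fun {i j} h ↦ by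
    simp only [pathGraph_adj] at h; simp only [ne_eq, Fin.mk.injEq]; omega⟩

lemma colorable_compl_pathGraph_six : (pathGraph 6)ᶜ.Colorable 3 :=
  ⟨Coloring.mk (fun i ↦ ⟨i / 2, by omega⟩) fun {i j} h ↦ by
    simp only [compl_adj, pathGraph_adj] at h
    simp only [ne_eq, Fin.mk.injEq]; omega⟩

lemma colorable_cycleGraph_six : (cycleGraph 6).Colorable 2 :=
  ⟨Coloring.mk (fun i ↦ ⟨i % 2, by omega⟩) fun {i j} ↦ by revert i j; decide⟩

lemma colorable_compl_cycleGraph_six : (cycleGraph 6)ᶜ.Colorable 3 :=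
  ⟨Coloring.mk (fun i ↦ ⟨i / 2, by omega⟩) fun {i j} ↦ by revert i j; decide⟩

/-- A `1`-HNG graph has no induced `P₆`, no induced `C_m` for `m ≥ 6`, and no
induced complement of `P₆` or of `C_m` for `m ≥ 6`. -/
theorem stmt_10 {V : Type*} [Fintype V] (G : SimpleGraph V) (hG : IsHNG G 1) :
    ¬ HasInducedCopy G (pathGraph 6) ∧
    (∀ m : ℕ, 6 ≤ m → ¬ HasInducedCopy G (cycleGraph m)) ∧
    ¬ HasInducedCopy G (pathGraph 6)ᶜ ∧
    (∀ m : ℕ, 6 ≤ m → ¬ HasInducedCopy G (cycleGraph m)ᶜ) := by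
  have key {H : SimpleGraph (Fin 6)} (h₂ : H.Colorable 2) (h₃ : Hᶜ.Colorable 3) :
      IsEmpty (H ↪g G) ∧ IsEmpty (Hᶜ ↪g G) := by
    refine ⟨⟨fun f ↦ ?_⟩, ⟨fun f ↦ ?_⟩⟩
    · simpa using hG.card_le_add_of_colorable f h₂ h₃
    · have := hG.card_le_add_of_colorable f h₃ ((compl_compl H).symm ▸ h₂)
      simp at this
  have hP := key colorable_pathGraph_six colorable_compl_pathGraph_six
  have hC := key colorable_cycleGraph_six colorable_compl_cycleGraph_six
  refine ⟨fun h ↦ ?_, fun m hm h ↦ ?_, fun h ↦ ?_, fun m hm h ↦ ?_⟩ <;>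
    obtain ⟨f⟩ := h.nonempty_embedding
  · exact hP.1.false f
  · obtain rfl | hm := hm.eq_or_lt
    · exact hC.1.false f
    · exact hP.1.false (f.comp (pathGraphSixEmbeddingCycleGraph m hm))
  · exact hP.2.false f
  · obtain rfl | hm := hm.eq_or_lt
    · exact hC.2.false f
    · exact hP.2.false (f.comp (Embedding.complEquiv (pathGraphSixEmbeddingCycleGraph m hm)))
end

section
/- If a finite simple graph G is 1-HNG, then G is perfect if and only if G contains no induced cycle on five vertices. -/
open SimpleGraph

/-- `G` is perfect: every induced subgraph `H` satisfies `χ(H) = ω(H)`. -/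
def IsPerfect {V : Type*} [Fintype V] (G : SimpleGraph V) : Prop :=
  ∀ s : Finset V, chi (G.induce (s : Set V)) = (G.induce (s : Set V)).cliqueNum

lemma chi_le_iff_colorable {V : Type*} [Finite V] {G : SimpleGraph V} {k : ℕ} :
    chi G ≤ k ↔ G.Colorable k := by
  refine ⟨fun h => (colorable_chromaticNumber_of_fintype G).mono h, fun h => ?_⟩
  have hle := h.chromaticNumber_le
  exact ENat.toNat_le_of_le_natCast hle

lemma cliqueNum_le_chi {V : Type*} [Finite V] (G : SimpleGraph V) : G.cliqueNum ≤ chi G := by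
  have h : G.Colorable (chi G) := chi_le_iff_colorable.1 le_rfl
  exact_mod_cast G.cliqueNum_le_chromaticNumber.trans h.chromaticNumber_le

lemma theta_induce {V : Type*} (G : SimpleGraph V) (s : Set V) :
    theta (G.induce s) = chi (Gᶜ.induce s) := by
  have h : (G.induce s)ᶜ = Gᶜ.induce s := by
    ext u v
    simp [Subtype.ext_iff]
  rw [theta, h]

lemma card_le_cliqueNum_induce {V : Type*} {G : SimpleGraph V} {s t : Finset V}
    (hts : t ⊆ s) (ht : G.IsClique (t : Set V)) :
    t.card ≤ (G.induce (s : Set V)).cliqueNum := by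
  classical
  have hc : (G.induce (s : Set V)).IsClique
      ((t.subtype (· ∈ (s : Set V)) : Finset (s : Set V)) : Set (s : Set V)) := by
    intro u hu v hv huv
    rw [Finset.mem_coe, Finset.mem_subtype] at hu hv
    exact ht hu hv (fun h => huv (Subtype.ext h))
  have h := hc.card_le_cliqueNum
  rwa [Finset.card_subtype, Finset.filter_true_of_mem (by exact fun x hx => hts hx)] at h

lemma exists_isClique_card_eq_cliqueNum_induce {V : Type*} (G : SimpleGraph V) (s : Finset V) :
    ∃ t ⊆ s, G.IsClique (t : Set V) ∧ t.card = (G.induce (s : Set V)).cliqueNum := by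
  obtain ⟨t, ht⟩ := (G.induce (s : Set V)).exists_isNClique_cliqueNum
  refine ⟨t.map (Function.Embedding.subtype _), ?_, ?_, ?_⟩
  · intro x hx
    obtain ⟨y, -, rfl⟩ := Finset.mem_map.1 hx
    exact y.2
  · intro u hu v hv huv
    simp only [Finset.coe_map, Set.mem_image, Finset.mem_coe] at hu hv
    obtain ⟨u, hu, rfl⟩ := hu
    obtain ⟨v, hv, rfl⟩ := hv
    exact ht.isClique hu hv (fun h => huv (congrArg _ h))
  · rw [Finset.card_map, ht.card_eq]

lemma cliqueNum_induce_mono {V : Type*} (G : SimpleGraph V) {s t : Finset V} (hts : t ⊆ s) :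
    (G.induce (t : Set V)).cliqueNum ≤ (G.induce (s : Set V)).cliqueNum := by
  obtain ⟨q, hqt, hq, hcard⟩ := exists_isClique_card_eq_cliqueNum_induce G t
  exact hcard ▸ card_le_cliqueNum_induce (hqt.trans hts) hq

lemma colorable_induce_add_one {V : Type*} [DecidableEq V] {G : SimpleGraph V} {s A : Finset V}
    {k : ℕ} (hA : Gᶜ.IsClique (A : Set V))
    (h : (G.induce ((s \ A : Finset V) : Set V)).Colorable k) :
    (G.induce (s : Set V)).Colorable (k + 1) := by
  obtain ⟨c⟩ := h
  refine ⟨Coloring.mk (fun v => if hv : (v : V) ∈ A then Fin.last k else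
    (c ⟨v, Finset.mem_coe.2 (Finset.mem_sdiff.2 ⟨v.2, hv⟩)⟩).castSucc) ?_⟩
  intro u v huv
  by_cases hu : (u : V) ∈ A <;> by_cases hv : (v : V) ∈ A
  · exact absurd huv (hA hu hv (fun h => huv.ne (Subtype.ext h))).2
  · simpa [hu, hv] using (Fin.castSucc_lt_last _).ne'
  · simp [hu, hv]
  · simp only [hu, hv, dite_false, ne_eq, Fin.castSucc_inj]
    exact c.valid huv

/-- A family of subsets of `s` whose incidence matrix with another family is the all-ones matrix
minus the identity has at most `s.card` members. -/
lemma card_le_of_card_inter_eq {ι V : Type*} [Fintype ι] [DecidableEq ι] [DecidableEq V]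
    {s : Finset V} {A Q : ι → Finset V} (hι : Fintype.card ι ≠ 1) (hQ : ∀ i, Q i ⊆ s)
    (h : ∀ i j, (Q i ∩ A j).card = if i = j then 0 else 1) : Fintype.card ι ≤ s.card := by
  have hli : LinearIndependent ℚ (fun (j : ι) (v : s) => if (v : V) ∈ A j then (1 : ℚ) else 0) := by
    rw [Fintype.linearIndependent_iff]
    intro g hg
    have hsum : ∀ i, ∑ j, g j * (if i = j then 0 else 1) = 0 := by
      intro i
      have hinter : ∀ j, (if i = j then (0 : ℚ) else 1)
          = ∑ v ∈ Q i, if v ∈ A j then (1 : ℚ) else 0 := by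
        intro j
        rw [Finset.sum_boole, Finset.filter_mem_eq_inter, h i j]
        push_cast
        rfl
      simp_rw [hinter, Finset.mul_sum]
      rw [Finset.sum_comm]
      refine Finset.sum_eq_zero fun v hv => ?_
      simpa using congrFun hg ⟨v, hQ i hv⟩
    have hall : ∀ i, g i = ∑ j, g j := by
      intro i
      have h1 : ∑ j, g j * (if i = j then (0 : ℚ) else 1) = ∑ j, (g j - if i = j then g j else 0) :=
        Finset.sum_congr rfl fun j _ => by split_ifs <;> simp
      have h2 := hsum i
      rw [h1, Finset.sum_sub_distrib, Finset.sum_ite_eq] at h2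
      simp only [Finset.mem_univ, if_true] at h2
      linarith
    have htotal : ∑ j, g j = Fintype.card ι * ∑ j, g j := by
      conv_lhs => rw [Finset.sum_congr rfl fun i _ => hall i]
      simp
    have hcard : (Fintype.card ι : ℚ) - 1 ≠ 0 := sub_ne_zero.2 (by exact_mod_cast hι)
    have hzero : ∑ j, g j = 0 := by
      have : ((Fintype.card ι : ℚ) - 1) * ∑ j, g j = 0 := by linarith
      exact (mul_eq_zero.1 this).resolve_left hcard
    exact fun i => (hall i).trans hzero
  simpa using hli.fintype_card_le_finrank

/-- Gasparyan's argument: a minimally imperfect graph has more than `α ω` vertices. -/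
lemma mul_cliqueNum_lt_card_of_not_colorable {V : Type*} {G : SimpleGraph V} {s : Finset V}
    (hs : ¬ (G.induce (s : Set V)).Colorable (G.induce (s : Set V)).cliqueNum)
    (ih : ∀ t ⊂ s, (G.induce (t : Set V)).Colorable (G.induce (t : Set V)).cliqueNum) :
    (Gᶜ.induce (s : Set V)).cliqueNum * (G.induce (s : Set V)).cliqueNum < s.card := by
  classical
  obtain ⟨A₀, hA₀s, hA₀, hA₀card⟩ := exists_isClique_card_eq_cliqueNum_induce Gᶜ s
  rw [← hA₀card]
  set w := (G.induce (s : Set V)).cliqueNum with hw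
  have hcol : ∀ v : A₀, ∃ c : V → Option (Fin w), (∀ u ∈ s, u ≠ v → ∃ i, c u = some i) ∧
      c v = none ∧ ∀ u ∈ s, ∀ u' ∈ s, u ≠ v → G.Adj u u' → c u ≠ c u' := by
    intro v
    have hvs : (v : V) ∈ s := hA₀s v.2
    obtain ⟨c⟩ := (ih _ (Finset.erase_ssubset hvs)).mono
      (cliqueNum_induce_mono G (Finset.erase_subset _ _))
    refine ⟨fun u => if hu : u ∈ s.erase v then some (c ⟨u, hu⟩) else none, ?_, by simp, ?_⟩
    · intro u hu huv
      exact ⟨_, dif_pos (Finset.mem_erase.2 ⟨huv, hu⟩)⟩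
    · intro u hu u' hu' huv hadj
      have h1 : u ∈ s.erase v := Finset.mem_erase.2 ⟨huv, hu⟩
      by_cases h2 : u' ∈ s.erase v
      · simp only [h1, h2, dite_true, ne_eq, Option.some.injEq]
        exact c.valid (v := ⟨u, h1⟩) (w := ⟨u', h2⟩) hadj
      · simp [h1, h2]
  choose c hc hcv hcadj using hcol
  let A : Option (A₀ × Fin w) → Finset V := fun o =>
    o.elim A₀ fun p => s.filter fun u => c p.1 u = some p.2
  have hAstable : ∀ o, Gᶜ.IsClique (A o : Set V) := by
    rintro (_ | ⟨v, i⟩)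
    · exact hA₀
    · intro u hu u' hu' huu'
      simp only [A, Option.elim, Finset.coe_filter, Set.mem_ofPred_eq] at hu hu'
      refine ⟨huu', fun hadj => hcadj v u hu.1 u' hu'.1 ?_ hadj (hu.2.trans hu'.2.symm)⟩
      rintro rfl
      simp [hcv] at hu
  have hex : ∀ o, ∃ q ⊆ s, G.IsClique (q : Set V) ∧ q.card = w ∧ q ∩ A o = ∅ := by
    intro o
    obtain ⟨q, hqs, hq, hqcard⟩ := exists_isClique_card_eq_cliqueNum_induce G (s \ A o)
    have hwle : w ≤ q.card := by
      by_contra! hlt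
      have hcolor : (G.induce ((s \ A o : Finset V) : Set V)).Colorable q.card := by
        rw [hqcard]
        apply ih
        refine Finset.sdiff_subset.ssubset_of_ne fun heq => ?_
        rw [heq] at hqcard
        omega
      exact hs ((colorable_induce_add_one (hAstable o) hcolor).mono hlt)
    obtain ⟨q', hq', hcard⟩ := Finset.exists_subset_card_eq hwle
    refine ⟨q', (hq'.trans hqs).trans Finset.sdiff_subset,
      hq.subset (by exact_mod_cast hq'), hcard, ?_⟩
    rw [← Finset.disjoint_iff_inter_eq_empty]
    exact Finset.sdiff_disjoint.mono_left (hq'.trans hqs)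
  choose Q hQs hQ hQcard hQA using hex
  have hinj : ∀ (q : Finset V), q ⊆ s → G.IsClique (q : Set V) → ∀ (v : A₀),
      Set.InjOn (c v) (q : Set V) := by
    intro q hqs hq v u hu u' hu' heq
    by_contra hne
    by_cases huv : u = v
    · exact hcadj v u' (hqs hu') u (hqs hu) (fun h => hne (huv.trans h.symm))
        (hq hu' hu (Ne.symm hne)) heq.symm
    · exact hcadj v u (hqs hu) u' (hqs hu') huv (hq hu hu' hne) heq
  have hmem : ∀ (q : Finset V), q ⊆ s → G.IsClique (q : Set V) → q.card = w → ∀ (v : A₀)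
      (i : Fin w), q ∩ A (some (v, i)) = ∅ → (v : V) ∈ q ∧
        ∀ j, q ∩ A (some (v, j)) = ∅ → i = j := by
    intro q hqs hq hqcard v i hi
    have hnot : ∀ j, q ∩ A (some (v, j)) = ∅ → some j ∉ q.image (c v) := by
      intro j hj hmem
      obtain ⟨u, hu, huc⟩ := Finset.mem_image.1 hmem
      have : u ∈ q ∩ A (some (v, j)) := by simp [A, hu, hqs hu, huc]
      simp [hj] at this
    have hcardim : (q.image (c v)).card = w := by
      rw [Finset.card_image_of_injOn (hinj q hqs hq v), hqcard]
    have key : ∀ T : Finset (Option (Fin w)), Disjoint T (q.image (c v)) → T.card ≤ 1 := by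
      intro T hT
      have h1 := Finset.card_le_univ (T ∪ q.image (c v))
      rw [Finset.card_union_of_disjoint hT, hcardim, Fintype.card_option, Fintype.card_fin] at h1
      omega
    constructor
    · by_contra hv
      have h1 := key {none, some i} (by
        rw [Finset.disjoint_left]
        intro x hx
        simp only [Finset.mem_insert, Finset.mem_singleton] at hx
        rcases hx with rfl | rfl
        · intro hmem
          obtain ⟨u, hu, huc⟩ := Finset.mem_image.1 hmem
          obtain ⟨j, hj⟩ := hc v u (hqs hu) (fun h => hv (h ▸ hu))
          simp [hj] at huc
        · exact hnot i hi)
      simp at h1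
    · intro j hj
      by_contra hij
      have h1 := key {some i, some j} (by
        rw [Finset.disjoint_left]
        intro x hx
        simp only [Finset.mem_insert, Finset.mem_singleton] at hx
        rcases hx with rfl | rfl
        · exact hnot i hi
        · exact hnot j hj)
      rw [Finset.card_pair (by simpa using hij)] at h1
      omega
  have hunique : ∀ (q : Finset V), q ⊆ s → G.IsClique (q : Set V) → q.card = w → ∀ o o',
      q ∩ A o = ∅ → q ∩ A o' = ∅ → o = o' := by
    intro q hqs hq hqcard
    have hnone : ∀ p, q ∩ A none = ∅ → q ∩ A (some p) = ∅ → False := by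
      rintro ⟨v, i⟩ h0 h1
      have : (v : V) ∈ q ∩ A none :=
        Finset.mem_inter.2 ⟨(hmem q hqs hq hqcard v i h1).1, v.2⟩
      simp [h0] at this
    rintro (_ | ⟨v, i⟩) (_ | ⟨v', i'⟩) h h'
    · rfl
    · exact (hnone _ h h').elim
    · exact (hnone _ h' h).elim
    · have hv := hmem q hqs hq hqcard v i h
      have hv' := hmem q hqs hq hqcard v' i' h'
      have hvv : v = v' := by
        by_contra hne
        have hne' : (v : V) ≠ v' := fun h => hne (Subtype.ext h)
        exact (hA₀ v.2 v'.2 hne').2 (hq hv.1 hv'.1 hne')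
      subst hvv
      rw [hv.2 i' h']
  have hcardι : Fintype.card (Option (A₀ × Fin w)) = A₀.card * w + 1 := by simp
  have hspos : 0 < s.card := by
    rw [Finset.card_pos, Finset.nonempty_iff_ne_empty]
    rintro rfl
    have : IsEmpty (((∅ : Finset V) : Set V) : Type _) := by simp
    exact hs (.of_isEmpty _)
  rcases Nat.eq_zero_or_pos (A₀.card * w) with h0 | hpos
  · omega
  · have := card_le_of_card_inter_eq (A := A) (Q := Q) (s := s) (by omega) hQs (by
      intro o o'
      split_ifs with hoo
      · subst hoo
        simp [hQA]
      · refine le_antisymm (Finset.card_le_one.2 ?_) (Finset.card_pos.2 ?_)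
        · intro a ha b hb
          by_contra hab
          rw [Finset.mem_inter] at ha hb
          exact (hAstable o' ha.2 hb.2 hab).2 (hQ o ha.1 hb.1 hab)
        · rw [Finset.nonempty_iff_ne_empty]
          exact fun h => hoo (hunique _ (hQs o) (hQ o) (hQcard o) _ _ (hQA o) h))
    omega

/-- One direction of Lovász's characterization of perfect graphs. -/
lemma colorable_cliqueNum_of_card_le_mul {V : Type*} {G : SimpleGraph V} {s : Finset V}
    (h : ∀ t ⊆ s, t.card ≤ (Gᶜ.induce (t : Set V)).cliqueNum * (G.induce (t : Set V)).cliqueNum) :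
    (G.induce (s : Set V)).Colorable (G.induce (s : Set V)).cliqueNum := by
  induction s using Finset.strongInduction with
  | H s ih =>
    by_contra hs
    exact (mul_cliqueNum_lt_card_of_not_colorable hs
      fun t ht => ih t ht fun r hr => h r (hr.trans ht.1)).not_ge (h s subset_rfl)

/-- A graph on five vertices with neither a triangle nor an independent triple is a `C₅`. -/
lemma nonempty_iso_cycleGraph_five {V : Type*} {G : SimpleGraph V} {s : Finset V}
    (hs : s.card = 5) (hw : (G.induce (s : Set V)).cliqueNum ≤ 2)
    (ha : (Gᶜ.induce (s : Set V)).cliqueNum ≤ 2) :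
    Nonempty (G.induce (s : Set V) ≃g cycleGraph 5) := by
  classical
  have tri : ∀ a ∈ s, ∀ b ∈ s, ∀ c ∈ s, G.Adj a b → G.Adj a c → G.Adj b c → False := by
    intro a ha b hb c hc hab hac hbc
    have h3 : G.IsNClique 3 {a, b, c} := is3Clique_triple_iff.2 ⟨hab, hac, hbc⟩
    have := card_le_cliqueNum_induce (s := s) (by simp [Finset.insert_subset_iff, *]) h3.isClique
    have := h3.card_eq
    omega
  have ind : ∀ a ∈ s, ∀ b ∈ s, ∀ c ∈ s, a ≠ b → a ≠ c → b ≠ c →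
      ¬ G.Adj a b → ¬ G.Adj a c → G.Adj b c := by
    intro a ha b hb c hc hab hac hbc nab nac
    by_contra nbc
    have h3 : Gᶜ.IsNClique 3 {a, b, c} :=
      is3Clique_triple_iff.2 ⟨⟨hab, nab⟩, ⟨hac, nac⟩, ⟨hbc, nbc⟩⟩
    have := card_le_cliqueNum_induce (s := s) (by simp [Finset.insert_subset_iff, *]) h3.isClique
    have := h3.card_eq
    omega
  obtain ⟨a, has⟩ : s.Nonempty := Finset.card_pos.1 (by omega)
  have hN : ((s.erase a).filter (G.Adj a)).card ≤ 2 := by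
    refine (card_le_cliqueNum_induce (s := s) (G := Gᶜ) ?_ ?_).trans ha
    · exact (Finset.filter_subset _ _).trans (Finset.erase_subset _ _)
    · intro u hu v hv huv
      simp only [Finset.coe_filter, Finset.mem_erase, Set.mem_ofPred_eq] at hu hv
      exact ⟨huv, fun h => tri a has u hu.1.2 v hv.1.2 hu.2 hv.2 h⟩
  have hM : ((s.erase a).filter fun v => ¬ G.Adj a v).card ≤ 2 := by
    refine (card_le_cliqueNum_induce (s := s) (G := G) ?_ ?_).trans hw
    · exact (Finset.filter_subset _ _).trans (Finset.erase_subset _ _)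
    · intro u hu v hv huv
      simp only [Finset.coe_filter, Finset.mem_erase, Set.mem_ofPred_eq] at hu hv
      exact ind a has u hu.1.2 v hv.1.2 hu.1.1.symm hv.1.1.symm huv hu.2 hv.2
  have hsum := Finset.card_filter_add_card_filter_not (s := s.erase a) (G.Adj a)
  rw [Finset.card_erase_of_mem has, hs] at hsum
  obtain ⟨b, e, hbe, hbeN⟩ := Finset.card_eq_two.1 (show _ = 2 by omega :
    ((s.erase a).filter (G.Adj a)).card = 2)
  obtain ⟨c, d, hcd, hcdM⟩ := Finset.card_eq_two.1 (show _ = 2 by omega :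
    ((s.erase a).filter fun v => ¬ G.Adj a v).card = 2)
  have hb : b ∈ (s.erase a).filter (G.Adj a) := by simp [hbeN]
  have he : e ∈ (s.erase a).filter (G.Adj a) := by simp [hbeN]
  have hc : c ∈ (s.erase a).filter fun v => ¬ G.Adj a v := by simp [hcdM]
  have hd : d ∈ (s.erase a).filter fun v => ¬ G.Adj a v := by simp [hcdM]
  clear hbeN hcdM hN hM hsum
  simp only [Finset.mem_filter, Finset.mem_erase] at hb he hc hd
  have nbe : ¬ G.Adj b e := fun h => tri a has b hb.1.2 e he.1.2 hb.2 he.2 h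
  have acd : G.Adj c d :=
    ind a has c hc.1.2 d hd.1.2 hc.1.1.symm hd.1.1.symm hcd hc.2 hd.2
  have build : ∀ c ∈ s, ∀ d ∈ s, c ≠ a → d ≠ a → ¬ G.Adj a c → ¬ G.Adj a d → G.Adj c d →
      G.Adj b c → Nonempty (G.induce (s : Set V) ≃g cycleGraph 5) := by
    intro c hcs d hds hca hda nac nad acd abc
    have hbc := abc.ne
    have hbd : b ≠ d := fun h => nad (h ▸ hb.2)
    have hec : e ≠ c := fun h => nac (h ▸ he.2)
    have hed : e ≠ d := fun h => nad (h ▸ he.2)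
    have nbd : ¬ G.Adj b d := fun h => tri b hb.1.2 c hcs d hds abc h acd
    have aed : G.Adj e d := ind b hb.1.2 e he.1.2 d hds hbe hbd hed nbe nbd
    have nec : ¬ G.Adj e c := fun h => tri e he.1.2 c hcs d hds h aed acd
    let f : Fin 5 → (s : Set V) :=
      ![⟨a, has⟩, ⟨b, hb.1.2⟩, ⟨c, hcs⟩, ⟨d, hds⟩, ⟨e, he.1.2⟩]
    have hf : Function.Injective f := by
      intro i j hij
      have hba := hb.1.1
      have hea := he.1.1
      have hcd := acd.ne
      fin_cases i <;> fin_cases j <;>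
        simp [f, hba, hba.symm, hea, hea.symm, hca, hca.symm, hda, hda.symm, hbc, hbc.symm, hbd,
          hbd.symm, hbe, hbe.symm, hec, hec.symm, hed, hed.symm, hcd, hcd.symm] at hij ⊢
    have hbij : Function.Bijective f := by
      rw [Fintype.bijective_iff_injective_and_card]
      exact ⟨hf, by simp [hs]⟩
    refine ⟨(RelIso.mk (Equiv.ofBijective f hbij) ?_ : cycleGraph 5 ≃g G.induce (s : Set V)).symm⟩
    intro i j
    have hab := hb.2
    have hae := he.2
    rw [Equiv.ofBijective_apply, Equiv.ofBijective_apply, cycleGraph_adj]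
    fin_cases i <;> fin_cases j <;>
      simp [f, G.adj_comm b a, G.adj_comm c a, G.adj_comm d a, G.adj_comm e a, G.adj_comm c b,
        G.adj_comm d b, G.adj_comm e b, G.adj_comm d c, G.adj_comm c e, G.adj_comm d e,
        hab, hae, nac, nad, acd, abc, nbd, aed, nec, nbe] <;> decide
  by_cases abc : G.Adj b c
  · exact build c hc.1.2 d hd.1.2 hc.1.1 hd.1.1 hc.2 hd.2 acd abc
  · refine build d hd.1.2 c hc.1.2 hd.1.1 hc.1.1 hd.2 hc.2 acd.symm ?_
    by_contra abd
    have hbc : b ≠ c := fun h => hc.2 (h ▸ hb.2)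
    have hbd : b ≠ d := fun h => hd.2 (h ▸ hb.2)
    have hec : e ≠ c := fun h => hc.2 (h ▸ he.2)
    have hed : e ≠ d := fun h => hd.2 (h ▸ he.2)
    exact tri c hc.1.2 d hd.1.2 e he.1.2 acd
      (ind b hb.1.2 c hc.1.2 e he.1.2 hbc hbe hec.symm abc nbe)
      (ind b hb.1.2 d hd.1.2 e he.1.2 hbd hbe hed.symm abd nbe)

lemma IsPerfect.not_hasInducedCopy_cycleGraph_five {V : Type*} [Fintype V] {G : SimpleGraph V}
    (hG : IsPerfect G) : ¬ HasInducedCopy G (cycleGraph 5) := by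
  rintro ⟨s, ⟨e⟩⟩
  have hfree : (cycleGraph 5).CliqueFree 3 := by
    intro t ht
    obtain ⟨a, b, c, hab, hac, hbc, -⟩ := is3Clique_iff.1 ht
    rw [cycleGraph_adj] at hab hac hbc
    revert a b c
    decide
  have hfree' : (G.induce (s : Set V)).CliqueFree 3 := hfree.comap ⟨e.toCopy⟩
  have hle : (G.induce (s : Set V)).cliqueNum ≤ 2 := by
    by_contra! hlt
    obtain ⟨t, ht⟩ := (G.induce (s : Set V)).exists_isNClique_cliqueNum
    exact hfree'.mono hlt t ht
  have hcol : (G.induce (s : Set V)).Colorable 2 :=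
    chi_le_iff_colorable.1 ((hG s).trans_le hle)
  have h2 := (hcol.of_hom e.symm.toHom).chromaticNumber_le
  rw [chromaticNumber_cycleGraph_of_odd 5 (by norm_num) (by decide)] at h2
  exact absurd h2 (by decide)

/-- A `1`-HNG set that is minimal for violating Lovász's inequality induces a `C₅`. -/
lemma IsHNG.nonempty_iso_cycleGraph_five {V : Type*} [Fintype V] {G : SimpleGraph V}
    (hG : IsHNG G 1) {s : Finset V}
    (hs : (Gᶜ.induce (s : Set V)).cliqueNum * (G.induce (s : Set V)).cliqueNum < s.card)
    (hmin : ∀ t ⊂ s,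
      t.card ≤ (Gᶜ.induce (t : Set V)).cliqueNum * (G.induce (t : Set V)).cliqueNum) :
    Nonempty (G.induce (s : Set V) ≃g cycleGraph 5) := by
  classical
  obtain ⟨v, hv⟩ : s.Nonempty := Finset.card_pos.1 (by omega)
  have hsub := Finset.erase_ssubset hv
  have hchi : chi (G.induce ((s.erase v : Finset V) : Set V)) ≤ _ :=
    chi_le_iff_colorable.2 (colorable_cliqueNum_of_card_le_mul fun t ht =>
      hmin t (ht.trans_ssubset hsub))
  have htheta : chi (Gᶜ.induce ((s.erase v : Finset V) : Set V)) ≤ _ :=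
    chi_le_iff_colorable.2 (colorable_cliqueNum_of_card_le_mul fun t ht => by
      rw [compl_compl, mul_comm]
      exact hmin t (ht.trans_ssubset hsub))
  have hw := cliqueNum_induce_mono G hsub.1
  have ha := cliqueNum_induce_mono Gᶜ hsub.1
  have hng := hG (s.erase v)
  have hcard := hmin _ hsub
  have hmul := Nat.mul_le_mul ha hw
  rw [theta_induce] at hng
  rw [Finset.card_erase_of_mem hv] at hng hcard
  have hclique : ∀ H : SimpleGraph V, (Hᶜ.induce (s : Set V)).cliqueNum ≤ 1 →
      s.card ≤ (H.induce (s : Set V)).cliqueNum := by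
    intro H hH
    refine card_le_cliqueNum_induce subset_rfl fun x hx y hy hxy => ?_
    by_contra hnadj
    have hpair : Hᶜ.IsClique (({x, y} : Finset V) : Set V) := by
      rw [Finset.coe_pair, isClique_pair]
      exact fun _ => ⟨hxy, hnadj⟩
    have := card_le_cliqueNum_induce (s := s) (Finset.insert_subset hx (by simpa using hy)) hpair
    rw [Finset.card_pair hxy] at this
    omega
  have hone : ∀ H : SimpleGraph V, 1 ≤ (H.induce (s : Set V)).cliqueNum := fun H => by
    simpa using card_le_cliqueNum_induce (G := H) (Finset.singleton_subset_iff.2 hv) (by simp)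
  have hw1 := hone G
  have ha1 := hone Gᶜ
  have hwc := hclique G
  have hac := hclique Gᶜ
  rw [compl_compl] at hac
  have ha2 : 2 ≤ (Gᶜ.induce (s : Set V)).cliqueNum := by
    by_contra! hlt
    nlinarith [hwc (by omega)]
  have hw2 : 2 ≤ (G.induce (s : Set V)).cliqueNum := by
    by_contra! hlt
    nlinarith [hac (by omega)]
  have hsum : (Gᶜ.induce (s : Set V)).cliqueNum * (G.induce (s : Set V)).cliqueNum ≤
      (Gᶜ.induce (s : Set V)).cliqueNum + (G.induce (s : Set V)).cliqueNum := by omega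
  have ha3 : (Gᶜ.induce (s : Set V)).cliqueNum ≤ 2 := by nlinarith
  have hw3 : (G.induce (s : Set V)).cliqueNum ≤ 2 := by nlinarith
  refine _root_.nonempty_iso_cycleGraph_five ?_ hw3 ha3
  rw [le_antisymm ha3 ha2, le_antisymm hw3 hw2] at hs hmul
  omega

/-- A `1`-HNG graph is perfect iff it contains no induced `C₅`. -/
theorem stmt_11 {V : Type*} [Fintype V] (G : SimpleGraph V) (hG : IsHNG G 1) :
    IsPerfect G ↔ ¬ HasInducedCopy G (cycleGraph 5) := by
  refine ⟨IsPerfect.not_hasInducedCopy_cycleGraph_five, fun hC s => ?_⟩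
  refine le_antisymm (chi_le_iff_colorable.2 ?_) (cliqueNum_le_chi _)
  refine colorable_cliqueNum_of_card_le_mul fun t _ => ?_
  induction t using Finset.strongInduction with
  | H t ih =>
    by_contra! hlt
    exact hC ⟨t, hG.nonempty_iso_cycleGraph_five hlt fun r hr => ih r hr (hr.1.trans ‹t ⊆ s›)⟩
end
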